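/- Assume that for every (n−1)×(n−1) homogeneous well-ordered integer matrix satisfying conditions (1) and (2), a general form of its degree is the determinant of a matrix of forms with that degree matrix. Let M = (m_{ij}) be a homogeneous, well-ordered n×n matrix of integers of degree d satisfying conditions (1) and (2), and suppose m_{i1} = 0 for some i. Then a general form of degree d in C[x_0,x_1,x_2] is the determinant of a matrix of forms whose degree matrix is M. -/

import Mathlib

open MvPolynomial Matrix

/-- `f` is a form of degree `m : ℤ` -/
def IsFormOfDeg {k : ℕ} (f : MvPolynomial (Fin k) ℂ) (m : ℤ) : Prop :=
  if m < 0 then f = 0 else f.IsHomogeneous m.toNat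

def HasDegMatrix {k a b : ℕ} (N : Matrix (Fin a) (Fin b) (MvPolynomial (Fin k) ℂ))
    (M : Matrix (Fin a) (Fin b) ℤ) : Prop :=
  ∀ i j, IsFormOfDeg (N i j) (M i j)

def IsHomogMatrix {a b : ℕ} (M : Matrix (Fin a) (Fin b) ℤ) : Prop :=
  ∀ (i i' : Fin a) (j j' : Fin b), i < i' → j < j' →
    M i j + M i' j' = M i j' + M i' j

def WellOrderedMatrix {a b : ℕ} (M : Matrix (Fin a) (Fin b) ℤ) : Prop :=
  (∀ (i i' : Fin a) (j : Fin b), i ≤ i' → M i' j ≤ M i j) ∧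
  (∀ (i : Fin a) (j j' : Fin b), j ≤ j' → M i j ≤ M i j')

/-- A property `P` holds for a general form of degree `d` in `k` variables. -/
def GeneralForm (k : ℕ) (d : ℤ) (P : MvPolynomial (Fin k) ℂ → Prop) : Prop :=
  ∃ Φ : MvPolynomial ((Fin k) →₀ ℕ) ℂ,
    (∃ f : MvPolynomial (Fin k) ℂ, IsFormOfDeg f d ∧ eval f.coeff Φ ≠ 0) ∧
    ∀ f : MvPolynomial (Fin k) ℂ, IsFormOfDeg f d → eval f.coeff Φ ≠ 0 → P f

noncomputable def minorsIdeal {k n : ℕ} (A : Matrix (Fin n) (Fin (n+1)) (MvPolynomial (Fin k) ℂ)) :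
    Ideal (MvPolynomial (Fin k) ℂ) :=
  Ideal.span (Set.range fun j : Fin (n+1) => (A.submatrix id j.succAbove).det)

def IsZeroDimIdeal (I : Ideal (MvPolynomial (Fin 3) ℂ)) : Prop :=
  ringKrullDim (MvPolynomial (Fin 3) ℂ ⧸ I) = 1

noncomputable def hilbFn (I : Ideal (MvPolynomial (Fin 3) ℂ)) (t : ℕ) : ℕ :=
  Module.finrank ℂ (homogeneousSubmodule (Fin 3) ℂ t) -
    Module.finrank ℂ
      (Submodule.restrictScalars ℂ I ⊓ homogeneousSubmodule (Fin 3) ℂ t : Submodule ℂ _)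

noncomputable def hilbFnZ (I : Ideal (MvPolynomial (Fin 3) ℂ)) (t : ℤ) : ℕ :=
  if t < 0 then 0 else hilbFn I t.toNat

def Cond2 {n : ℕ} (M : Matrix (Fin n) (Fin n) ℤ) : Prop :=
  ∀ (t : ℕ) (_ : 1 ≤ t) (h2 : t < n),
    M ⟨t, h2⟩ ⟨t - 1, by omega⟩ < 0 →
      ((∑ i : Fin (n - t), M ⟨t + i.1, by have := i.2; omega⟩ ⟨t + i.1, by have := i.2; omega⟩) = 0
        ∨ (∑ i : Fin (n - t), M ⟨t + i.1, by have := i.2; omega⟩ ⟨t + i.1, by have := i.2; omega⟩)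
            = ∑ i, M i i)

theorem IsHomogMatrix.add_eq {a b : ℕ} {M : Matrix (Fin a) (Fin b) ℤ} (hM : IsHomogMatrix M)
    (i i' : Fin a) (j j' : Fin b) : M i j + M i' j' = M i j' + M i' j := by
  rcases lt_trichotomy i i' with hi | rfl | hi
  · rcases lt_trichotomy j j' with hj | rfl | hj
    · exact hM i i' j j' hi hj
    · rfl
    · exact (hM i i' j' j hi hj).symm
  · exact add_comm _ _
  · rcases lt_trichotomy j j' with hj | rfl | hj
    · linarith [hM i' i j j' hi hj]
    · rfl
    · linarith [hM i' i j' j hi hj]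

/-- The degree of a homogeneous matrix can be computed by expanding along the first column. -/
theorem IsHomogMatrix.sum_diag_eq {k : ℕ} {M : Matrix (Fin (k + 1)) (Fin (k + 1)) ℤ}
    (hM : IsHomogMatrix M) (p : Fin (k + 1)) :
    ∑ i, M i i = M p 0 + ∑ i : Fin k, M (p.succAbove i) i.succ := by
  have key : ∀ i j, M i j = M i 0 + (M 0 j - M 0 0) := fun i j => by
    linarith [hM.add_eq i 0 j 0]
  calc ∑ i, M i i = ∑ i, M i 0 + ∑ i, (M 0 i - M 0 0) := by
        rw [← Finset.sum_add_distrib]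
        exact Finset.sum_congr rfl fun i _ => key i i
    _ = M p 0 + ∑ i : Fin k, (M (p.succAbove i) 0 + (M 0 i.succ - M 0 0)) := by
        rw [Fin.sum_univ_succAbove (fun i => M i 0) p, Fin.sum_univ_succ (fun i => M 0 i - M 0 0),
          Finset.sum_add_distrib]
        ring
    _ = _ := by
        congr 1
        exact Finset.sum_congr rfl fun i _ => (key _ _).symm

theorem IsHomogMatrix.submatrix {a b a' b' : ℕ} {M : Matrix (Fin a) (Fin b) ℤ}
    (hM : IsHomogMatrix M) (r : Fin a' → Fin a) (c : Fin b' → Fin b) :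
    IsHomogMatrix (M.submatrix r c) :=
  fun _ _ _ _ _ _ => hM.add_eq _ _ _ _

theorem WellOrderedMatrix.submatrix {a b a' b' : ℕ} {M : Matrix (Fin a) (Fin b) ℤ}
    (hM : WellOrderedMatrix M) {r : Fin a' → Fin a} {c : Fin b' → Fin b}
    (hr : Monotone r) (hc : Monotone c) : WellOrderedMatrix (M.submatrix r c) :=
  ⟨fun _ _ _ h => hM.1 _ _ _ (hr h), fun _ _ _ h => hM.2 _ _ _ (hc h)⟩

theorem WellOrderedMatrix.nonneg_diag_submatrix_succ {k : ℕ}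
    {M : Matrix (Fin (k + 1)) (Fin (k + 1)) ℤ} (hM : WellOrderedMatrix M)
    (h1 : ∀ i, 0 ≤ M i i) (p : Fin (k + 1)) (i : Fin k) :
    0 ≤ M.submatrix p.succAbove Fin.succ i i :=
  (h1 i.succ).trans <| hM.1 _ _ _ <| by
    rw [Fin.succAbove]
    split_ifs
    exacts [i.castSucc_lt_succ.le, le_rfl]

theorem Cond2.submatrix_succ {k : ℕ} {M : Matrix (Fin (k + 1)) (Fin (k + 1)) ℤ}
    (h2 : Cond2 M) (hM : IsHomogMatrix M) (h1 : ∀ i, 0 ≤ M i i) {p : Fin (k + 1)}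
    (hp : M p 0 = 0) : Cond2 (M.submatrix p.succAbove Fin.succ) := by
  intro t ht htk hneg
  have hdeg := hM.sum_diag_eq p
  rw [hp, zero_add] at hdeg
  have hcol : Fin.succ (⟨t - 1, by omega⟩ : Fin k) = ⟨t, by omega⟩ := by
    ext; simp only [Fin.val_succ]; omega
  simp only [Matrix.submatrix_apply, hcol] at hneg ⊢
  by_cases hpt : t < p.1
  · rw [Fin.succAbove_of_castSucc_lt _ _ (by simpa [Fin.lt_def] using hpt)] at hneg
    exact absurd (h1 ⟨t, by omega⟩) (not_le.2 hneg)
  · have hsucc : ∀ s (hs : s < k), t ≤ s → p.succAbove ⟨s, hs⟩ = ⟨s + 1, by omega⟩ :=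
      fun s hs hts => Fin.succAbove_of_le_castSucc _ _ (by rw [Fin.le_def]; simp; omega)
    rw [hsucc t htk le_rfl] at hneg
    have := h2 (t + 1) (by omega) (by omega) hneg
    rw [← hdeg]
    convert this using 2 <;>
    · refine Fintype.sum_equiv (finCongr (by omega)) _ _ fun i => ?_
      rw [hsucc _ _ (by omega)]
      congr 1 <;> · ext; simp; omega

theorem isFormOfDeg_zero {k : ℕ} (m : ℤ) : IsFormOfDeg (0 : MvPolynomial (Fin k) ℂ) m := by
  unfold IsFormOfDeg
  split_ifs
  · rfl
  · exact isHomogeneous_zero _ _ _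

theorem isFormOfDeg_neg_one_pow {k : ℕ} (e : ℕ) :
    IsFormOfDeg ((-1 : MvPolynomial (Fin k) ℂ) ^ e) 0 := by
  rw [IsFormOfDeg, if_neg (lt_irrefl 0)]
  simpa using isHomogeneous_C (Fin k) ((-1 : ℂ) ^ e)

/-- A determinantal representation for the submatrix of the degree matrix obtained by deleting
the first column and a row whose first entry is `0` extends to one for the full matrix. -/
theorem exists_hasDegMatrix_det_eq {l k : ℕ} {M : Matrix (Fin (k + 1)) (Fin (k + 1)) ℤ}
    {p : Fin (k + 1)} (hp : M p 0 = 0) {N : Matrix (Fin k) (Fin k) (MvPolynomial (Fin l) ℂ)}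
    (hN : HasDegMatrix N (M.submatrix p.succAbove Fin.succ)) :
    ∃ N' : Matrix (Fin (k + 1)) (Fin (k + 1)) (MvPolynomial (Fin l) ℂ),
      HasDegMatrix N' M ∧ N'.det = N.det := by
  let row : Fin (k + 1) → MvPolynomial (Fin l) ℂ := Fin.cons ((-1) ^ (p : ℕ)) 0
  let N' : Matrix (Fin (k + 1)) (Fin (k + 1)) (MvPolynomial (Fin l) ℂ) :=
    p.insertNth (α := fun _ => Fin (k + 1) → MvPolynomial (Fin l) ℂ) row
      fun i => Fin.cons 0 (N i)
  have hrow : N' p = row := Fin.insertNth_apply_same ..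
  have hrest : ∀ i, N' (p.succAbove i) = Fin.cons 0 (N i) :=
    fun i => Fin.insertNth_apply_succAbove ..
  refine ⟨N', fun i j => ?_, ?_⟩
  · rcases Fin.eq_self_or_eq_succAbove p i with rfl | ⟨i, rfl⟩
    · rw [hrow]
      refine Fin.cases ?_ (fun j => ?_) j
      · rw [hp]; exact isFormOfDeg_neg_one_pow _
      · exact isFormOfDeg_zero _
    · rw [hrest]
      refine Fin.cases ?_ (fun j => ?_) j
      · exact isFormOfDeg_zero _
      · exact hN i j
  · have hsub : N'.submatrix p.succAbove Fin.succ = N := by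
      ext1 i j
      simp [hrest]
    rw [Matrix.det_succ_column_zero, Fin.sum_univ_succAbove _ p, hsub]
    simp [hrow, hrest, row, ← mul_pow]

/-- (Lemma 5.7.)  Assume inductively the main theorem for `(n-1)×(n-1)` matrices (here
of size `k`).  Let `M` be a homogeneous well-ordered `(k+1)×(k+1)` integer matrix of
degree `d` satisfying conditions (1) and (2), with `m_{i1} = 0` for some `i`.  Then a
general form of degree `d` in `ℂ[x₀,x₁,x₂]` is the determinant of a matrix of forms
with degree matrix `M`. -/
theorem stmt_10 {k : ℕ}
    (IH : ∀ M' : Matrix (Fin k) (Fin k) ℤ,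
      IsHomogMatrix M' → WellOrderedMatrix M' → (∀ i, 0 ≤ M' i i) → Cond2 M' →
      GeneralForm 3 (∑ i, M' i i)
        (fun F => ∃ N : Matrix (Fin k) (Fin k) (MvPolynomial (Fin 3) ℂ),
          HasDegMatrix N M' ∧ N.det = F))
    (M : Matrix (Fin (k + 1)) (Fin (k + 1)) ℤ)
    (hM : IsHomogMatrix M) (hMw : WellOrderedMatrix M)
    (h1 : ∀ i, 0 ≤ M i i) (h2 : Cond2 M)
    (d : ℤ) (hd : d = ∑ i, M i i)
    (hz : ∃ i, M i 0 = 0) :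
    GeneralForm 3 d (fun F =>
      ∃ N : Matrix (Fin (k + 1)) (Fin (k + 1)) (MvPolynomial (Fin 3) ℂ),
        HasDegMatrix N M ∧ N.det = F) := by
  obtain ⟨p, hp⟩ := hz
  obtain ⟨Φ, hΦ, hrep⟩ := IH _ (hM.submatrix p.succAbove Fin.succ)
    (hMw.submatrix (Fin.strictMono_succAbove p).monotone Fin.strictMono_succ.monotone)
    (hMw.nonneg_diag_submatrix_succ h1 p) (h2.submatrix_succ hM h1 hp)
  have hdeg : ∑ i, M.submatrix p.succAbove Fin.succ i i = d := by
    rw [hd, hM.sum_diag_eq p, hp, zero_add]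
    rfl
  rw [hdeg] at hΦ hrep
  refine ⟨Φ, hΦ, fun f hf hne => ?_⟩
  obtain ⟨N, hN, rfl⟩ := hrep f hf hne
  exact exists_hasDegMatrix_det_eq hp hN
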